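/- For every s > 0 there exist α > 0 and C > 0 such that for all integers n ≥ 1, all t ∈ ℝ, and all v, w : ℤ → ℂ with ‖v‖_{H^s}, ‖w‖_{H^s} < ∞: ‖N₁^{(−n)}(v)(t)‖_{H^s} ≤ C n^{−α} ‖v‖³_{H^s}, and ‖N₁^{(−n)}(v)(t) − N₁^{(−n)}(w)(t)‖_{H^s} ≤ C n^{−α} (‖v‖_{H^s} + ‖w‖_{H^s})² ‖v − w‖_{H^s}. -/

import Mathlib

open scoped ENNReal

/-- Japanese bracket `⟨k⟩ = 1 + |k|`. -/
noncomputable def jb (k : ℤ) : ℝ := 1 + |(k : ℝ)|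

/-- `‖f‖_{H^s} = (∑_k ⟨k⟩^{2s} |f k|²)^{1/2}`, valued in `[0,∞]`. -/
noncomputable def hnorm (s : ℝ) (f : ℤ → ℂ) : ℝ≥0∞ :=
  (∑' k : ℤ, ENNReal.ofReal (jb k ^ (2 * s) * ‖f k‖ ^ 2)) ^ (1 / 2 : ℝ)

/-- `Φ(k̄) = k³ − k₁³ − k₂³ − k₃³` with `k = k₁ + k₂ + k₃`. -/
def Phi (k₁ k₂ k₃ : ℤ) : ℤ := (k₁ + k₂ + k₃) ^ 3 - k₁ ^ 3 - k₂ ^ 3 - k₃ ^ 3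

/-- Boundary term `N₁^{(-n)}(v)(t)_k` from differentiation by parts, restricted to
`max(|k₁|,|k₂|,|k₃|) > n`. -/
noncomputable def N1n (n : ℕ) (v : ℤ → ℂ) (t : ℝ) (k : ℤ) : ℂ :=
  (1 / 3 : ℂ) * ∑' p : ℤ × ℤ,
    if Phi p.1 p.2 (k - p.1 - p.2) ≠ 0 ∧
        (n : ℤ) < max (max |p.1| |p.2|) |k - p.1 - p.2| then
      ((k : ℂ) / ((Phi p.1 p.2 (k - p.1 - p.2) : ℤ) : ℂ)) *
        Complex.exp (Complex.I * (t : ℂ) * ((Phi p.1 p.2 (k - p.1 - p.2) : ℤ) : ℂ)) *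
        v p.1 * v p.2 * v (k - p.1 - p.2)
    else 0

/-- The absolute value of the multiplier of `N1n`. -/
noncomputable def kern (n : ℕ) (k : ℤ) (p : ℤ × ℤ) : ℝ :=
  if Phi p.1 p.2 (k - p.1 - p.2) ≠ 0 ∧
      (n : ℤ) < max (max |p.1| |p.2|) |k - p.1 - p.2| then
    |(k : ℝ)| / |((Phi p.1 p.2 (k - p.1 - p.2) : ℤ) : ℝ)|
  else 0

/-- The trilinear form with positive coefficients which majorizes `N1n`. -/
noncomputable def triMaj (n : ℕ) (f g h : ℤ → ℂ) (k : ℤ) : ℝ≥0∞ :=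
  ∑' p : ℤ × ℤ, ENNReal.ofReal (kern n k p) *
    (‖f p.1‖ₑ * ‖g p.2‖ₑ * ‖h (k - p.1 - p.2)‖ₑ)

/-- The summand of `hnorm`, before squaring. -/
noncomputable def wt (s : ℝ) (f : ℤ → ℂ) (k : ℤ) : ℝ≥0∞ := ENNReal.ofReal (jb k ^ s) * ‖f k‖ₑ

/-- The decaying factor in the bounds for `kern`. -/
noncomputable def decay (x : ℤ) : ℝ := |(x : ℝ)| ^ (-(3 / 4) : ℝ)

lemma one_le_jb (k : ℤ) : 1 ≤ jb k := by
  unfold jb; linarith [abs_nonneg (k : ℝ)]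

lemma jb_pos (k : ℤ) : 0 < jb k := zero_lt_one.trans_le (one_le_jb k)

lemma decay_nonneg (x : ℤ) : 0 ≤ decay x := Real.rpow_nonneg (abs_nonneg _) _

lemma hnorm_sq (s : ℝ) (f : ℤ → ℂ) : hnorm s f ^ 2 = ∑' k, wt s f k ^ 2 := by
  unfold hnorm wt
  rw [← ENNReal.rpow_natCast, ← ENNReal.rpow_mul]
  norm_num
  refine tsum_congr fun k => ?_
  rw [ENNReal.ofReal_mul (Real.rpow_nonneg (jb_pos k).le _), mul_pow,
    ← ENNReal.ofReal_pow (Real.rpow_nonneg (jb_pos k).le _), ← Real.rpow_natCast (jb k ^ s),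
    ← Real.rpow_mul (jb_pos k).le, ENNReal.ofReal_pow (norm_nonneg _), ofReal_norm]
  congr 3
  push_cast; ring

lemma jb_add_le (x y : ℤ) : jb (x + y) ≤ jb x * jb y := by
  unfold jb
  push_cast
  nlinarith [abs_add_le (x : ℝ) y, abs_nonneg (x : ℝ), abs_nonneg (y : ℝ),
    mul_nonneg (abs_nonneg (x : ℝ)) (abs_nonneg (y : ℝ))]

lemma jb_add_three_le (x y z : ℤ) : jb (x + y + z) ≤ jb x * jb y * jb z :=
  (jb_add_le _ _).trans (mul_le_mul_of_nonneg_right (jb_add_le _ _) (jb_pos _).le)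

lemma one_le_abs_cast {a : ℤ} (ha : a ≠ 0) : (1 : ℝ) ≤ |(a : ℝ)| := by
  exact_mod_cast Int.one_le_abs ha

lemma abs_le_jb_mul {x y : ℤ} (h : x + y ≠ 0) : |(x : ℝ)| ≤ jb y * |((x + y : ℤ) : ℝ)| := by
  have h1 := one_le_abs_cast h
  have h2 : |(x : ℝ)| ≤ |((x + y : ℤ) : ℝ)| + |(y : ℝ)| := by
    push_cast
    simpa using abs_sub ((x : ℝ) + y) y
  unfold jb
  nlinarith [abs_nonneg (y : ℝ)]

lemma jb_mul_le {x y z : ℤ} {N : ℝ} (hN : 1 ≤ N) (hxy : x + y ≠ 0) (hyz : y + z ≠ 0)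
    (hmax : N ≤ max (max |(x : ℝ)| |(y : ℝ)|) |(z : ℝ)|) :
    jb (x + y + z) * N ≤
      4 * (jb x * jb y * jb z) * (|((x + y : ℤ) : ℝ)| * |((y + z : ℤ) : ℝ)|) := by
  set K := max (max |(x : ℝ)| |(y : ℝ)|) |(z : ℝ)| with hK
  have hx : |(x : ℝ)| ≤ K := (le_max_left _ _).trans (le_max_left _ _)
  have hy : |(y : ℝ)| ≤ K := (le_max_right _ _).trans (le_max_left _ _)
  have hz : |(z : ℝ)| ≤ K := le_max_right _ _
  have hA := one_le_abs_cast hxy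
  have hB := one_le_abs_cast hyz
  have e1 := abs_le_jb_mul hxy
  have e2 := abs_le_jb_mul (x := y) (y := x) (by rwa [add_comm])
  have e3 := abs_le_jb_mul (x := z) (y := y) (by rwa [add_comm])
  rw [add_comm y x] at e2
  rw [add_comm z y] at e3
  set A := |((x + y : ℤ) : ℝ)|
  set B := |((y + z : ℤ) : ℝ)|
  have hjx := one_le_jb x
  have hjy := one_le_jb y
  have hjz := one_le_jb z
  have hk : jb (x + y + z) ≤ 4 * K := by
    have := abs_add_three (x : ℝ) y z
    unfold jb
    push_cast
    linarith
  have hKK : K * K ≤ (jb x * jb y * jb z) * (A * B) := by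
    have ax : |(x : ℝ)| ≤ jb x := by unfold jb; linarith
    have ay : |(y : ℝ)| ≤ jb y := by unfold jb; linarith
    have az : |(z : ℝ)| ≤ jb z := by unfold jb; linarith
    have key : ∀ u v w : ℝ, ∀ a b : ℝ, 1 ≤ u → 1 ≤ v → 1 ≤ w → 1 ≤ a → 1 ≤ b →
        K ≤ u → K ≤ v * a → K * K ≤ (u * v * w) * (a * b) := by
      intro u v w a b hu hv hw ha hb h1 h2
      have h3 : K * K ≤ u * (v * a) := mul_le_mul h1 h2 (by linarith) (by linarith)
      have h4 : 1 ≤ w * b := one_le_mul_of_one_le_of_one_le hw hb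
      calc K * K ≤ u * (v * a) := h3
        _ ≤ u * (v * a) * (w * b) := le_mul_of_one_le_right (by positivity) h4
        _ = _ := by ring
    rcases max_choice (max |(x : ℝ)| |(y : ℝ)|) |(z : ℝ)| with h | h
    · rcases max_choice |(x : ℝ)| |(y : ℝ)| with h' | h'
      · have : K = |(x : ℝ)| := by rw [hK, h, h']
        exact key _ _ _ _ _ hjx hjy hjz hA hB (this ▸ ax) (this ▸ e1)
      · have : K = |(y : ℝ)| := by rw [hK, h, h']
        have := key _ _ _ _ _ hjy hjx hjz hA hB (this ▸ ay) (this ▸ e2)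
        linarith
    · have : K = |(z : ℝ)| := by rw [hK, h]
      have := key _ _ _ _ _ hjz hjy hjx hB hA (this ▸ az) (this ▸ e3)
      linarith
  have hkpos := jb_pos (x + y + z)
  calc jb (x + y + z) * N ≤ (4 * K) * K := mul_le_mul hk hmax (by linarith) (by linarith)
    _ ≤ _ := by linarith

/-- The gain in `N` from one pair of the three resonance factors. -/
lemma rpow_jb_div_le {s σ : ℝ} (hσ : 0 < σ) (hσs : σ ≤ s) (hσ4 : σ ≤ 1 / 4) {x y z : ℤ} {N : ℝ}
    (hN : 1 ≤ N) (hxy : x + y ≠ 0) (hyz : y + z ≠ 0)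
    (hmax : N ≤ max (max |(x : ℝ)| |(y : ℝ)|) |(z : ℝ)|) :
    jb (x + y + z) ^ s / (|((x + y : ℤ) : ℝ)| * |((y + z : ℤ) : ℝ)|) ≤
      4 * N ^ (-σ) * (decay (x + y) * decay (y + z)) * (jb x * jb y * jb z) ^ s := by
  have hA := one_le_abs_cast hxy
  have hB := one_le_abs_cast hyz
  have hmain := jb_mul_le hN hxy hyz hmax
  have hP := jb_add_three_le x y z
  have hk := jb_pos (x + y + z)
  unfold decay
  rw [← Real.mul_rpow (abs_nonneg _) (abs_nonneg _)]
  have hD : 1 ≤ |((x + y : ℤ) : ℝ)| * |((y + z : ℤ) : ℝ)| :=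
    one_le_mul_of_one_le_of_one_le hA hB
  set D := |((x + y : ℤ) : ℝ)| * |((y + z : ℤ) : ℝ)|
  set P := jb x * jb y * jb z
  set k := jb (x + y + z)
  have hP0 : 0 < P := hk.trans_le hP
  have hN0 : 0 < N := by linarith
  have hD0 : 0 < D := by linarith
  have h1 : k ^ σ * N ^ σ ≤ 4 * P ^ σ * D ^ (1 / 4 : ℝ) := by
    calc k ^ σ * N ^ σ = (k * N) ^ σ := (Real.mul_rpow hk.le hN0.le).symm
      _ ≤ (4 * P * D) ^ σ := Real.rpow_le_rpow (by positivity) hmain hσ.le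
      _ = 4 ^ σ * P ^ σ * D ^ σ := by
        rw [Real.mul_rpow (by positivity) hD0.le, Real.mul_rpow (by norm_num) hP0.le]
      _ ≤ 4 ^ (1 : ℝ) * P ^ σ * D ^ (1 / 4 : ℝ) := by
        gcongr
        · norm_num
        · linarith
      _ = _ := by rw [Real.rpow_one]
  have h2 : k ^ (s - σ) ≤ P ^ (s - σ) := Real.rpow_le_rpow hk.le hP (by linarith)
  have h3 : k ^ s * N ^ σ ≤ 4 * P ^ s * D ^ (1 / 4 : ℝ) := by
    calc k ^ s * N ^ σ = k ^ (s - σ) * (k ^ σ * N ^ σ) := by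
          rw [← mul_assoc, ← Real.rpow_add hk]; congr 2; ring
      _ ≤ P ^ (s - σ) * (4 * P ^ σ * D ^ (1 / 4 : ℝ)) := by gcongr
      _ = 4 * (P ^ (s - σ) * P ^ σ) * D ^ (1 / 4 : ℝ) := by ring
      _ = _ := by rw [← Real.rpow_add hP0]; congr 3; ring
  have hD1 : D ^ (1 / 4 : ℝ) = D ^ (-(3 / 4) : ℝ) * D := by
    rw [← Real.rpow_add_one hD0.ne']; norm_num
  rw [div_le_iff₀ hD0, Real.rpow_neg hN0.le]
  have hNs : 0 < N ^ σ := Real.rpow_pos_of_pos hN0 _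
  rw [hD1] at h3
  calc k ^ s = k ^ s * N ^ σ * (N ^ σ)⁻¹ := by field_simp
    _ ≤ (4 * P ^ s * (D ^ (-(3 / 4) : ℝ) * D)) * (N ^ σ)⁻¹ := by gcongr
    _ = _ := by ring

lemma Phi_eq (x y z : ℤ) : Phi x y z = 3 * ((x + y) * (y + z) * (z + x)) := by
  unfold Phi; ring

/-- The decaying part of the bound for `kern`. -/
noncomputable def decaySum (x y z : ℤ) : ℝ :=
  decay (x + y) * decay (y + z) + decay (y + z) * decay (z + x) + decay (z + x) * decay (x + y)

lemma decaySum_nonneg (x y z : ℤ) : 0 ≤ decaySum x y z := by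
  have := decay_nonneg
  unfold decaySum
  have h1 := mul_nonneg (this (x + y)) (this (y + z))
  have h2 := mul_nonneg (this (y + z)) (this (z + x))
  have h3 := mul_nonneg (this (z + x)) (this (x + y))
  linarith

lemma abs_div_Phi_mul_le {s σ : ℝ} (hσ : 0 < σ) (hσs : σ ≤ s) (hσ4 : σ ≤ 1 / 4) {x y z : ℤ}
    {N : ℝ} (hN : 1 ≤ N) (hPhi : Phi x y z ≠ 0)
    (hmax : N ≤ max (max |(x : ℝ)| |(y : ℝ)|) |(z : ℝ)|) :
    jb (x + y + z) ^ s * (|((x + y + z : ℤ) : ℝ)| / |(Phi x y z : ℝ)|) ≤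
      4 * N ^ (-σ) * decaySum x y z * (jb x * jb y * jb z) ^ s := by
  rw [Phi_eq] at hPhi ⊢
  have hxy : x + y ≠ 0 := by rintro h; simp [h] at hPhi
  have hyz : y + z ≠ 0 := by rintro h; simp [h] at hPhi
  have hzx : z + x ≠ 0 := by rintro h; simp [h] at hPhi
  have h1 := rpow_jb_div_le hσ hσs hσ4 hN hxy hyz hmax
  have h2 := rpow_jb_div_le (x := y) (y := z) (z := x) hσ hσs hσ4 hN hyz hzx
    (by rwa [max_comm, ← max_assoc])
  have h3 := rpow_jb_div_le (x := z) (y := x) (z := y) hσ hσs hσ4 hN hzx hxy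
    (by rwa [max_assoc, max_comm])
  rw [show y + z + x = x + y + z by ring, show jb y * jb z * jb x = jb x * jb y * jb z by ring]
    at h2
  rw [show z + x + y = x + y + z by ring, show jb z * jb x * jb y = jb x * jb y * jb z by ring]
    at h3
  have hk : |((x + y + z : ℤ) : ℝ)| ≤ 3 *
      (|((x + y : ℤ) : ℝ)| + |((y + z : ℤ) : ℝ)| + |((z + x : ℤ) : ℝ)|) := by
    have h := abs_add_three ((x + y : ℤ) : ℝ) ((y + z : ℤ) : ℝ) ((z + x : ℤ) : ℝ)
    have h' : ((x + y : ℤ) : ℝ) + ((y + z : ℤ) : ℝ) + ((z + x : ℤ) : ℝ) =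
        2 * ((x + y + z : ℤ) : ℝ) := by push_cast; ring
    rw [h', abs_mul, abs_two] at h
    linarith [abs_nonneg ((x + y + z : ℤ) : ℝ)]
  have hA := one_le_abs_cast hxy
  have hB := one_le_abs_cast hyz
  have hC := one_le_abs_cast hzx
  have hcast : |((3 * ((x + y) * (y + z) * (z + x)) : ℤ) : ℝ)| =
      3 * (|((x + y : ℤ) : ℝ)| * |((y + z : ℤ) : ℝ)| * |((z + x : ℤ) : ℝ)|) := by
    rw [Int.cast_mul, Int.cast_mul, Int.cast_mul, abs_mul, abs_mul, abs_mul]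
    norm_num
  rw [hcast]
  have hJ : 0 ≤ jb (x + y + z) ^ s := Real.rpow_nonneg (jb_pos _).le _
  unfold decaySum
  set A := |((x + y : ℤ) : ℝ)|
  set B := |((y + z : ℤ) : ℝ)|
  set C := |((z + x : ℤ) : ℝ)|
  set J := jb (x + y + z) ^ s
  have hA0 : 0 < A := by linarith
  have hB0 : 0 < B := by linarith
  have hC0 : 0 < C := by linarith
  calc J * (|((x + y + z : ℤ) : ℝ)| / (3 * (A * B * C)))
      ≤ J * (3 * (A + B + C) / (3 * (A * B * C))) := by gcongr
    _ = J / (A * B) + J / (B * C) + J / (C * A) := by field_simp; ring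
    _ ≤ _ := by linarith

lemma kern_nonneg (n : ℕ) (k : ℤ) (p : ℤ × ℤ) : 0 ≤ kern n k p := by
  unfold kern; split_ifs <;> positivity

lemma rpow_jb_mul_kern_le {s σ : ℝ} (hσ : 0 < σ) (hσs : σ ≤ s) (hσ4 : σ ≤ 1 / 4) {n : ℕ}
    (hn : 1 ≤ n) (k : ℤ) (p : ℤ × ℤ) :
    jb k ^ s * kern n k p ≤ 4 * (n : ℝ) ^ (-σ) * decaySum p.1 p.2 (k - p.1 - p.2) *
      (jb p.1 ^ s * jb p.2 ^ s * jb (k - p.1 - p.2) ^ s) := by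
  have j := fun x => (jb_pos x).le
  rw [← Real.mul_rpow (j _) (j _), ← Real.mul_rpow (mul_nonneg (j _) (j _)) (j _)]
  unfold kern
  split_ifs with h
  · have hmax : (n : ℝ) ≤
        max (max |(p.1 : ℝ)| |(p.2 : ℝ)|) |((k - p.1 - p.2 : ℤ) : ℝ)| := by
      exact_mod_cast h.2.le
    have := abs_div_Phi_mul_le hσ hσs hσ4 (by exact_mod_cast hn) h.1 hmax
    rwa [show p.1 + p.2 + (k - p.1 - p.2) = k by ring] at this
  · rw [mul_zero]
    have := decaySum_nonneg p.1 p.2 (k - p.1 - p.2)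
    have h3 : 0 ≤ (jb p.1 * jb p.2 * jb (k - p.1 - p.2)) ^ s :=
      Real.rpow_nonneg (mul_nonneg (mul_nonneg (j _) (j _)) (j _)) _
    positivity

lemma ENNReal.sq_tsum_mul_le {ι : Type*} (f g : ι → ℝ≥0∞) :
    (∑' i, f i * g i) ^ 2 ≤ (∑' i, f i ^ 2) * ∑' i, g i ^ 2 := by
  have h : ∑' i, f i * g i ≤ (∑' i, f i ^ 2) ^ (1 / 2 : ℝ) * (∑' i, g i ^ 2) ^ (1 / 2 : ℝ) := by
    rw [ENNReal.tsum_eq_iSup_sum]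
    refine iSup_le fun t => ?_
    refine (ENNReal.inner_le_Lp_mul_Lq t f g Real.HolderConjugate.two_two).trans ?_
    simp only [ENNReal.rpow_two]
    gcongr <;> exact ENNReal.sum_le_tsum _
  refine (pow_le_pow_left₀ zero_le h 2).trans_eq ?_
  rw [mul_pow, ← ENNReal.rpow_natCast, ← ENNReal.rpow_natCast, ← ENNReal.rpow_mul,
    ← ENNReal.rpow_mul]
  norm_num

lemma ENNReal.add_three_sq_le (a b c : ℝ≥0∞) :
    (a + b + c) ^ 2 ≤ 3 * (a ^ 2 + b ^ 2 + c ^ 2) := by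
  have h := ENNReal.sq_tsum_mul_le (fun _ => 1) ![a, b, c]
  simp only [tsum_fintype, Fin.sum_univ_three] at h
  norm_num at h
  simpa using h

/-- The sum of `|x| ^ (-3/2)` over the integers. -/
noncomputable def decayTotal : ℝ := ∑' x : ℤ, decay x ^ 2

lemma decayTotal_nonneg : 0 ≤ decayTotal := tsum_nonneg fun _ => sq_nonneg _

lemma tsum_decay_sq : ∑' x : ℤ, ENNReal.ofReal (decay x) ^ 2 = ENNReal.ofReal decayTotal := by
  have hs : Summable fun x : ℤ => decay x ^ 2 := by
    refine (Real.summable_abs_int_rpow (b := 3 / 2) (by norm_num)).congr fun x => ?_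
    unfold decay
    rw [← Real.rpow_natCast, ← Real.rpow_mul (abs_nonneg _)]
    norm_num
  rw [decayTotal, ENNReal.ofReal_tsum_of_nonneg (fun _ => sq_nonneg _) hs]
  exact tsum_congr fun x => (ENNReal.ofReal_pow (decay_nonneg x) 2).symm

lemma tsum_decay_mul_decay_sq_le {φ : ℤ × ℤ → ℤ × ℤ} (hφ : Function.Injective φ) :
    ∑' p : ℤ × ℤ, ENNReal.ofReal (decay (φ p).1 * decay (φ p).2) ^ 2 ≤
      ENNReal.ofReal decayTotal ^ 2 := by
  refine (ENNReal.tsum_comp_le_tsum_of_injective hφ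
    fun q : ℤ × ℤ => ENNReal.ofReal (decay q.1 * decay q.2) ^ 2).trans_eq ?_
  rw [ENNReal.tsum_prod (f := fun x y => ENNReal.ofReal (decay x * decay y) ^ 2)]
  simp_rw [ENNReal.ofReal_mul (decay_nonneg _), mul_pow, ENNReal.tsum_mul_left, tsum_decay_sq,
    ENNReal.tsum_mul_right, tsum_decay_sq]
  ring

lemma tsum_decaySum_sq_le (k : ℤ) :
    ∑' p : ℤ × ℤ, ENNReal.ofReal (decaySum p.1 p.2 (k - p.1 - p.2)) ^ 2 ≤
      9 * ENNReal.ofReal decayTotal ^ 2 := by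
  have h1 := tsum_decay_mul_decay_sq_le
    (φ := fun p => (p.1 + p.2, p.2 + (k - p.1 - p.2))) (fun p q h => by
      simp only [Prod.mk.injEq] at h; ext <;> omega)
  have h2 := tsum_decay_mul_decay_sq_le
    (φ := fun p => (p.2 + (k - p.1 - p.2), k - p.1 - p.2 + p.1)) (fun p q h => by
      simp only [Prod.mk.injEq] at h; ext <;> omega)
  have h3 := tsum_decay_mul_decay_sq_le
    (φ := fun p => (k - p.1 - p.2 + p.1, p.1 + p.2)) (fun p q h => by
      simp only [Prod.mk.injEq] at h; ext <;> omega)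
  have d := decay_nonneg
  have dd := fun x y => mul_nonneg (d x) (d y)
  calc _ ≤ ∑' p : ℤ × ℤ, 3 *
        (ENNReal.ofReal (decay (p.1 + p.2) * decay (p.2 + (k - p.1 - p.2))) ^ 2 +
          ENNReal.ofReal (decay (p.2 + (k - p.1 - p.2)) * decay (k - p.1 - p.2 + p.1)) ^ 2 +
          ENNReal.ofReal (decay (k - p.1 - p.2 + p.1) * decay (p.1 + p.2)) ^ 2) := by
        refine ENNReal.tsum_le_tsum fun p => ?_
        rw [decaySum, ENNReal.ofReal_add (add_nonneg (dd _ _) (dd _ _)) (dd _ _),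
          ENNReal.ofReal_add (dd _ _) (dd _ _)]
        exact ENNReal.add_three_sq_le _ _ _
    _ ≤ 3 * (ENNReal.ofReal decayTotal ^ 2 + ENNReal.ofReal decayTotal ^ 2 +
          ENNReal.ofReal decayTotal ^ 2) := by
        rw [ENNReal.tsum_mul_left, ENNReal.tsum_add, ENNReal.tsum_add]
        gcongr
    _ = _ := by ring

lemma tsum_tsum_convolution (f g h : ℤ → ℝ≥0∞) :
    ∑' k : ℤ, ∑' p : ℤ × ℤ, f p.1 * g p.2 * h (k - p.1 - p.2) =
      (∑' k, f k) * (∑' k, g k) * ∑' k, h k := by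
  rw [ENNReal.tsum_comm]
  have (p : ℤ × ℤ) : ∑' k : ℤ, f p.1 * g p.2 * h (k - p.1 - p.2) =
      f p.1 * g p.2 * ∑' k, h k := by
    rw [ENNReal.tsum_mul_left, ← (Equiv.subRight (p.1 + p.2)).tsum_eq h]
    simp [sub_sub]
  simp_rw [this]
  rw [ENNReal.tsum_mul_right, ENNReal.tsum_prod (f := fun x y => f x * g y)]
  simp_rw [ENNReal.tsum_mul_left, ENNReal.tsum_mul_right]

/-- The constant of the trilinear estimate. -/
noncomputable def triConst (n : ℕ) (σ : ℝ) : ℝ := 12 * (decayTotal + 1) * (n : ℝ) ^ (-σ)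

lemma tsum_triMaj_sq_le {s σ : ℝ} (hσ : 0 < σ) (hσs : σ ≤ s) (hσ4 : σ ≤ 1 / 4) {n : ℕ}
    (hn : 1 ≤ n) (f g h : ℤ → ℂ) :
    ∑' k, (ENNReal.ofReal (jb k ^ s) * triMaj n f g h k) ^ 2 ≤
      (ENNReal.ofReal (triConst n σ) * (hnorm s f * hnorm s g * hnorm s h)) ^ 2 := by
  have j := fun x => Real.rpow_nonneg (jb_pos x).le s
  have hns : 0 ≤ 4 * (n : ℝ) ^ (-σ) := by positivity
  have hpt (k : ℤ) : ENNReal.ofReal (jb k ^ s) * triMaj n f g h k ≤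
      ENNReal.ofReal (4 * (n : ℝ) ^ (-σ)) * ∑' p : ℤ × ℤ,
        ENNReal.ofReal (decaySum p.1 p.2 (k - p.1 - p.2)) *
          (wt s f p.1 * wt s g p.2 * wt s h (k - p.1 - p.2)) := by
    rw [triMaj, ← ENNReal.tsum_mul_left, ← ENNReal.tsum_mul_left]
    refine ENNReal.tsum_le_tsum fun p => ?_
    have hd := decaySum_nonneg p.1 p.2 (k - p.1 - p.2)
    have := ENNReal.ofReal_le_ofReal (rpow_jb_mul_kern_le hσ hσs hσ4 hn k p)
    rw [ENNReal.ofReal_mul (j _), ENNReal.ofReal_mul (mul_nonneg hns hd), ENNReal.ofReal_mul hns,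
      ENNReal.ofReal_mul (mul_nonneg (j _) (j _)), ENNReal.ofReal_mul (j _)] at this
    unfold wt
    rw [← mul_assoc]
    refine (mul_le_mul_left this _).trans_eq ?_
    ring
  have hsq (k : ℤ) : (ENNReal.ofReal (jb k ^ s) * triMaj n f g h k) ^ 2 ≤
      ENNReal.ofReal (triConst n σ) ^ 2 *
        ∑' p : ℤ × ℤ, wt s f p.1 ^ 2 * wt s g p.2 ^ 2 * wt s h (k - p.1 - p.2) ^ 2 := by
    refine (pow_le_pow_left₀ zero_le (hpt k) 2).trans ?_
    rw [mul_pow]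
    refine (mul_le_mul_right (ENNReal.sq_tsum_mul_le _ _) _).trans ?_
    simp_rw [mul_pow]
    rw [← mul_assoc]
    refine mul_le_mul_left ?_ _
    refine (mul_le_mul_right (tsum_decaySum_sq_le k) _).trans ?_
    rw [show (9 : ℝ≥0∞) = ENNReal.ofReal 3 ^ 2 by norm_num, ← mul_pow, ← mul_pow,
      ← ENNReal.ofReal_mul (by norm_num), ← ENNReal.ofReal_mul hns]
    gcongr
    unfold triConst
    nlinarith [decayTotal_nonneg]
  refine (ENNReal.tsum_le_tsum hsq).trans_eq ?_
  rw [ENNReal.tsum_mul_left, tsum_tsum_convolution (fun k => wt s f k ^ 2) (fun k => wt s g k ^ 2)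
    (fun k => wt s h k ^ 2), ← hnorm_sq, ← hnorm_sq, ← hnorm_sq]
  ring

lemma triMaj_ne_top {s : ℝ} (hs : 0 < s) {n : ℕ} (hn : 1 ≤ n) {f g h : ℤ → ℂ}
    (hf : hnorm s f < ⊤) (hg : hnorm s g < ⊤) (hh : hnorm s h < ⊤) (k : ℤ) :
    triMaj n f g h k ≠ ⊤ := by
  intro htop
  have h1 := (ENNReal.le_tsum k).trans (tsum_triMaj_sq_le (s := s) (σ := min s (1 / 4))
    (lt_min hs (by norm_num)) (min_le_left _ _) (min_le_right _ _) hn f g h)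
  rw [htop, ENNReal.mul_top (by simpa using Real.rpow_pos_of_pos (jb_pos k) s)] at h1
  refine (h1.trans_lt (ENNReal.pow_lt_top (ENNReal.mul_lt_top ENNReal.ofReal_lt_top
    (ENNReal.mul_lt_top (ENNReal.mul_lt_top hf hg) hh)))).ne (by simp)

/-- The trilinear summand of which the diagonal values are summed in `N1n`. -/
noncomputable def triTerm (n : ℕ) (t : ℝ) (f g h : ℤ → ℂ) (k : ℤ) (p : ℤ × ℤ) : ℂ :=
  if Phi p.1 p.2 (k - p.1 - p.2) ≠ 0 ∧
      (n : ℤ) < max (max |p.1| |p.2|) |k - p.1 - p.2| then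
    ((k : ℂ) / ((Phi p.1 p.2 (k - p.1 - p.2) : ℤ) : ℂ)) *
      Complex.exp (Complex.I * (t : ℂ) * ((Phi p.1 p.2 (k - p.1 - p.2) : ℤ) : ℂ)) *
      f p.1 * g p.2 * h (k - p.1 - p.2)
  else 0

lemma N1n_eq (n : ℕ) (v : ℤ → ℂ) (t : ℝ) (k : ℤ) :
    N1n n v t k = (1 / 3 : ℂ) * ∑' p : ℤ × ℤ, triTerm n t v v v k p := rfl

lemma enorm_triTerm (n : ℕ) (t : ℝ) (f g h : ℤ → ℂ) (k : ℤ) (p : ℤ × ℤ) :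
    ‖triTerm n t f g h k p‖ₑ =
      ENNReal.ofReal (kern n k p) * (‖f p.1‖ₑ * ‖g p.2‖ₑ * ‖h (k - p.1 - p.2)‖ₑ) := by
  unfold triTerm kern
  split_ifs with hc
  · have he : ‖Complex.exp (Complex.I * (t : ℂ) *
        ((Phi p.1 p.2 (k - p.1 - p.2) : ℤ) : ℂ))‖ₑ = 1 := by
      rw [← ofReal_norm, Complex.norm_exp]
      simp
    have hq : ‖(k : ℂ) / ((Phi p.1 p.2 (k - p.1 - p.2) : ℤ) : ℂ)‖ₑ =
        ENNReal.ofReal (|(k : ℝ)| / |((Phi p.1 p.2 (k - p.1 - p.2) : ℤ) : ℝ)|) := by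
      rw [← ofReal_norm, norm_div, Complex.norm_intCast, Complex.norm_intCast]
    rw [enorm_mul, enorm_mul, enorm_mul, enorm_mul, he, hq]
    ring
  · simp

lemma tsum_enorm_triTerm (n : ℕ) (t : ℝ) (f g h : ℤ → ℂ) (k : ℤ) :
    ∑' p, ‖triTerm n t f g h k p‖ₑ = triMaj n f g h k :=
  tsum_congr fun p => enorm_triTerm n t f g h k p

lemma summable_triTerm {n : ℕ} {f g h : ℤ → ℂ} {k : ℤ} (t : ℝ) (hfin : triMaj n f g h k ≠ ⊤) :
    Summable (triTerm n t f g h k) := by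
  rw [← tsum_enorm_triTerm n t] at hfin
  exact Summable.of_nnnorm (ENNReal.tsum_coe_ne_top_iff_summable.1 hfin)

lemma enorm_third_mul_tsum_le (F : ℤ × ℤ → ℂ) :
    ‖(1 / 3 : ℂ) * ∑' p, F p‖ₑ ≤ ∑' p, ‖F p‖ₑ := by
  have h3 : ‖(1 / 3 : ℂ)‖ₑ ≤ 1 := by
    rw [← ofReal_norm]
    norm_num
  rw [enorm_mul]
  exact (mul_le_mul_left h3 _).trans (by rw [one_mul]; exact enorm_tsum_le_tsum_enorm)

lemma enorm_N1n_le (n : ℕ) (v : ℤ → ℂ) (t : ℝ) (k : ℤ) : ‖N1n n v t k‖ₑ ≤ triMaj n v v v k := by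
  rw [N1n_eq, ← tsum_enorm_triTerm n t]
  exact enorm_third_mul_tsum_le _

lemma enorm_N1n_sub_le {n : ℕ} {v w : ℤ → ℂ} {k : ℤ} (t : ℝ) (hv : triMaj n v v v k ≠ ⊤)
    (hw : triMaj n w w w k ≠ ⊤) :
    ‖N1n n v t k - N1n n w t k‖ₑ ≤ triMaj n (fun k => v k - w k) v v k +
      triMaj n w (fun k => v k - w k) v k + triMaj n w w (fun k => v k - w k) k := by
  rw [N1n_eq, N1n_eq, ← mul_sub, ← (summable_triTerm t hv).tsum_sub (summable_triTerm t hw)]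
  refine (enorm_third_mul_tsum_le _).trans ?_
  simp_rw [← tsum_enorm_triTerm n t, ← ENNReal.tsum_add]
  refine ENNReal.tsum_le_tsum fun p => ?_
  refine le_trans (le_of_eq ?_) ((enorm_add_le _ _).trans (add_le_add_left (enorm_add_le _ _) _))
  congr 1
  unfold triTerm
  split_ifs
  · ring
  · simp

lemma hnorm_le_of_tsum_le {s : ℝ} {f : ℤ → ℂ} {X : ℝ≥0∞} (h : ∑' k, wt s f k ^ 2 ≤ X ^ 2) :
    hnorm s f ≤ X := by
  rw [← hnorm_sq] at h
  exact (ENNReal.pow_le_pow_left_iff two_ne_zero).1 h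

/-- Estimates for the boundary term `N₁^{(-n)}`: a gain of `n^{-α}` for `s > 0`. -/
theorem N1n_estimates (s : ℝ) (hs : 0 < s) :
    ∃ α > (0 : ℝ), ∃ C > (0 : ℝ), ∀ n : ℕ, 1 ≤ n → ∀ t : ℝ,
      ∀ v w : ℤ → ℂ, hnorm s v < ⊤ → hnorm s w < ⊤ →
        hnorm s (fun k => N1n n v t k) ≤
          ENNReal.ofReal (C * (n : ℝ) ^ (-α)) * hnorm s v ^ 3 ∧
        hnorm s (fun k => N1n n v t k - N1n n w t k) ≤
          ENNReal.ofReal (C * (n : ℝ) ^ (-α)) * (hnorm s v + hnorm s w) ^ 2 *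
            hnorm s (fun k => v k - w k) := by
  set σ := min s (1 / 4)
  have hσ : 0 < σ := lt_min hs (by norm_num)
  have hσs : σ ≤ s := min_le_left _ _
  have hσ4 : σ ≤ 1 / 4 := min_le_right _ _
  have hG := decayTotal_nonneg
  refine ⟨σ, hσ, 36 * (decayTotal + 1), by positivity, fun n hn t v w hv hw => ?_⟩
  have hC : ENNReal.ofReal (36 * (decayTotal + 1) * (n : ℝ) ^ (-σ)) =
      3 * ENNReal.ofReal (triConst n σ) := by
    rw [show (3 : ℝ≥0∞) = ENNReal.ofReal 3 by norm_num, ← ENNReal.ofReal_mul (by norm_num)]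
    congr 1
    unfold triConst
    ring
  rw [hC]
  have hE := tsum_triMaj_sq_le hσ hσs hσ4 hn
  set c := ENNReal.ofReal (triConst n σ)
  constructor
  · have : hnorm s (fun k => N1n n v t k) ≤ c * (hnorm s v * hnorm s v * hnorm s v) := by
      refine hnorm_le_of_tsum_le (le_trans (ENNReal.tsum_le_tsum fun k => ?_) (hE v v v))
      unfold wt
      gcongr
      exact enorm_N1n_le n v t k
    calc _ ≤ c * (hnorm s v * hnorm s v * hnorm s v) := this
      _ = 1 * c * hnorm s v ^ 3 := by ring
      _ ≤ _ := by gcongr; norm_num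
  · set d : ℤ → ℂ := fun k => v k - w k
    set V := hnorm s v
    set W := hnorm s w
    set D := hnorm s d
    refine hnorm_le_of_tsum_le ?_
    calc _ ≤ ∑' k, 3 * ((ENNReal.ofReal (jb k ^ s) * triMaj n d v v k) ^ 2 +
          (ENNReal.ofReal (jb k ^ s) * triMaj n w d v k) ^ 2 +
          (ENNReal.ofReal (jb k ^ s) * triMaj n w w d k) ^ 2) := by
          refine ENNReal.tsum_le_tsum fun k => ?_
          refine le_trans ?_ (ENNReal.add_three_sq_le _ _ _)
          rw [← mul_add, ← mul_add]
          unfold wt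
          gcongr
          exact enorm_N1n_sub_le t (triMaj_ne_top hs hn hv hv hv k)
            (triMaj_ne_top hs hn hw hw hw k)
      _ ≤ 3 * ((c * (D * V * V)) ^ 2 + (c * (W * D * V)) ^ 2 + (c * (W * W * D)) ^ 2) := by
          rw [ENNReal.tsum_mul_left, ENNReal.tsum_add, ENNReal.tsum_add]
          gcongr
          · exact hE d v v
          · exact hE w d v
          · exact hE w w d
      _ ≤ 3 * ((c * (D * (V + W) * (V + W))) ^ 2 + (c * ((V + W) * D * (V + W))) ^ 2 +
            (c * ((V + W) * (V + W) * D)) ^ 2) := by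
          have h1 : V ≤ V + W := le_self_add
          have h2 : W ≤ V + W := le_add_self
          gcongr
      _ = _ := by ring
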